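/- Let P be a d×d complex orthogonal projection (P² = P, P† = P) of rank r, and let w be a d×d Hermitian matrix whose operator norm satisfies ‖w‖² ≤ 1/d. Then ‖P w + w P − P w P‖₂² ≤ 2r/d, where ‖X‖₂² = Tr(X† X) is the squared Frobenius norm. (This is the statement that every rank-r state has coherence parameter ν₂ = 1 with respect to any operator basis, such as the normalized Pauli basis, whose elements have operator norm at most 1/√d.) -/

import Mathlib

noncomputable section
open Matrix Complex

theorem trace_conjTranspose_mul_self_re {m n : Type*} [Fintype m] [Fintype n]
    (A : Matrix m n ℂ) :
    (trace (Aᴴ * A)).re = ∑ j, ‖WithLp.toLp 2 (A.col j)‖ ^ 2 := by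
  simp [trace, mul_apply, EuclideanSpace.norm_sq_eq, ← Complex.normSq_eq_norm_sq,
    Complex.normSq_apply]

theorem trace_conjTranspose_mul_self_mul_re_le {m n : Type*} [Fintype m] [DecidableEq m]
    [Fintype n] (A : Matrix m m ℂ) (B : Matrix m n ℂ) :
    (trace ((A * B)ᴴ * (A * B))).re ≤
      ‖toEuclideanCLM (𝕜 := ℂ) A‖ ^ 2 * (trace (Bᴴ * B)).re := by
  simp only [trace_conjTranspose_mul_self_re, Finset.mul_sum]
  refine Finset.sum_le_sum fun j _ => ?_
  rw [← mul_pow]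
  gcongr
  exact (toEuclideanCLM (𝕜 := ℂ) A).le_opNorm (WithLp.toLp 2 (B.col j))

theorem trace_eq_rank_of_isIdempotentElem {n K : Type*} [Fintype n] [DecidableEq n] [Field K]
    {P : Matrix n n K} (hP : IsIdempotentElem P) : trace P = P.rank := by
  have h : IsIdempotentElem (toLin' P) := by
    rw [IsIdempotentElem, Module.End.mul_eq_comp, ← toLin'_mul, hP.eq]
  rw [← trace_toLin'_eq, (LinearMap.IsIdempotentElem.isProj_range _ h).trace]
  rfl

theorem trace_conjTranspose_mul_self_re_nonneg {m n : Type*} [Fintype m] [Fintype n]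
    (A : Matrix m n ℂ) : 0 ≤ (trace (Aᴴ * A)).re := by
  rw [trace_conjTranspose_mul_self_re]
  positivity

theorem trace_sq_corner {n R : Type*} [Fintype n] [CommRing R] {P : Matrix n n R}
    (hP : P * P = P) (w : Matrix n n R) :
    trace ((P * w + w * P - P * w * P) * (P * w + w * P - P * w * P)) =
      2 * trace (P * w * (w * P)) - trace (P * w * P * (P * w * P)) := by
  have h (A : Matrix n n R) : P * (P * A) = P * A := by rw [← mul_assoc, hP]
  have h₁ : trace (w * (P * (w * P))) = trace (P * (w * (P * w))) := by
    rw [trace_mul_comm]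
    simp only [mul_assoc]
  have h₂ : trace (P * (w * (P * (w * P)))) = trace (P * (w * (P * w))) := by
    rw [trace_mul_comm]
    simp only [mul_assoc, hP, h₁]
  have h₃ : trace (P * (w * (w * P))) = trace (w * (P * w)) := by
    rw [trace_mul_comm]
    simp only [mul_assoc, hP]
    rw [trace_mul_comm]
    simp only [mul_assoc]
  simp only [mul_add, mul_sub, add_mul, sub_mul, mul_assoc, h, trace_add, trace_sub, h₁, h₂, h₃]
  ring

/-- for a `d×d` orthogonal projection `P` (`P² = P`, `P† = P`) of rank `r` and a
Hermitian matrix `w` whose operator norm satisfies `‖w‖² ≤ 1/d`, the squared Frobenius norm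
satisfies `‖P w + w P − P w P‖₂² ≤ 2r/d`.  (Every rank-`r` state has coherence `ν₂ = 1` with
respect to an operator basis whose elements have operator norm at most `1/√d`.) -/
theorem coherence_nu2_bound {d : ℕ}
    (P w : Matrix (Fin d) (Fin d) ℂ) (r : ℕ)
    (hP2 : P * P = P) (hP : Pᴴ = P) (hrank : P.rank = r) (hw : wᴴ = w)
    (hnorm : ‖Matrix.toEuclideanCLM (𝕜 := ℂ) w‖ ^ 2 ≤ 1 / (d : ℝ)) :
    (Matrix.trace ((P * w + w * P - P * w * P)ᴴ * (P * w + w * P - P * w * P))).re ≤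
      2 * (r : ℝ) / (d : ℝ) := by
  have hX : (P * w + w * P - P * w * P)ᴴ = P * w + w * P - P * w * P := by
    simp only [conjTranspose_sub, conjTranspose_add, conjTranspose_mul, hP, hw, mul_assoc]
    abel
  have h₁ := trace_conjTranspose_mul_self_mul_re_le w P
  have h₂ := trace_conjTranspose_mul_self_re_nonneg (P * w * P)
  have h₃ : (P * w * P)ᴴ = P * w * P := by simp only [conjTranspose_mul, hP, hw, mul_assoc]
  rw [hP, hP2, trace_eq_rank_of_isIdempotentElem hP2, hrank, conjTranspose_mul, hP, hw,
    natCast_re] at h₁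
  rw [h₃] at h₂
  rw [hX, trace_sq_corner hP2, sub_re, two_mul, add_re]
  have h₄ := mul_le_mul_of_nonneg_right hnorm r.cast_nonneg
  have h₅ : 2 * (r : ℝ) / d = 2 * (1 / d * r) := by ring
  linarith
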